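/- arXiv:1605.02758 — 3 statements merged into one kernel-verified Lean document; each statement's English description precedes it below -/
import Mathlib

section
/- Let a group G act without inversion on locally finite pocsets P and P', let f : P → P' be a G-equivariant resolution, and let h, k ∈ P be two halfspaces with f(h) = f(k). Then there exists a finite folding sequence P = P₀ ↝ P₁ ↝ ⋯ ↝ Pₙ for f such that the images of h and k in Pₙ are equal. -/
/- Pocsets, hyperplanes, admissible equivalence relations, quotients,
   admissible maps, embeddings, resolutions, group actions on pocsets,
   elementary folds and folding sequences. -/

universe u v w

/-- A pocset: a poset with an order-reversing involution `star` such that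
`h ≠ h *` and `h`, `h *` are incomparable. -/
structure Pocset (P : Type u) where
  le : P → P → Prop
  star : P → P
  le_refl : ∀ a, le a a
  le_trans : ∀ {a b c}, le a b → le b c → le a c
  le_antisymm : ∀ {a b}, le a b → le b a → a = b
  star_star : ∀ a, star (star a) = a
  star_antitone : ∀ {a b}, le a b → le (star b) (star a)
  ne_star : ∀ a, a ≠ star a
  not_le_star : ∀ a, ¬ le a (star a)
  not_star_le : ∀ a, ¬ le (star a) a

namespace Pocset

variable {P : Type u} {P' : Type v}

/-- Strict order. -/
def lt (Q : Pocset P) (a b : P) : Prop := Q.le a b ∧ a ≠ b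

/-- The orientations of the hyperplane `ĥ` determined by the halfspace `h`. -/
def orient (Q : Pocset P) (h : P) : Set P := {h, Q.star h}

/-- `k` is an orientation of the same hyperplane as `h`, i.e. `k̂ = ĥ`. -/
def sameHyp (Q : Pocset P) (h k : P) : Prop := k = h ∨ k = Q.star h

/-- The hyperplanes `ĥ` and `k̂` are transverse: they are distinct and no
orientation of `ĥ` is comparable with any orientation of `k̂`. -/
def transverse (Q : Pocset P) (h k : P) : Prop :=
  ¬ Q.sameHyp h k ∧ ∀ a ∈ Q.orient h, ∀ b ∈ Q.orient k, ¬ Q.le a b ∧ ¬ Q.le b a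

/-- Two hyperplanes are disjoint if they are distinct and not transverse. -/
def disjointHyp (Q : Pocset P) (h k : P) : Prop :=
  ¬ Q.sameHyp h k ∧ ¬ Q.transverse h k

/-- The halfspaces `h` and `k` are facing: `h* < k`. -/
def facing (Q : Pocset P) (h k : P) : Prop := Q.lt (Q.star h) k

/-- The halfspaces `h` and `k` are compatible: not `k ≤ h*`. -/
def compatible (Q : Pocset P) (h k : P) : Prop := ¬ Q.le k (Q.star h)

/-- The hyperplane `k̂` separates the hyperplanes `ĥ` and `l̂`: there are
orientations with `a < b < c`. -/
def separates (Q : Pocset P) (k h l : P) : Prop :=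
  ∃ a ∈ Q.orient h, ∃ b ∈ Q.orient k, ∃ c ∈ Q.orient l, Q.lt a b ∧ Q.lt b c

/-- Local finiteness: every interval is finite. -/
def LocallyFinite (Q : Pocset P) : Prop :=
  ∀ a b : P, {c : P | Q.le a c ∧ Q.le c b}.Finite

/-- The equivalence relation induced on hyperplanes by a relation `r` on
halfspaces: `ĥ ∼ k̂` iff `h ∼ k` or `h ∼ k*`. -/
def hypRel (Q : Pocset P) (r : P → P → Prop) (h k : P) : Prop :=
  r h k ∨ r h (Q.star k)

/-- An admissible equivalence relation on a pocset. -/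
structure IsAdmissible (Q : Pocset P) (r : P → P → Prop) : Prop where
  equiv : Equivalence r
  aer1 : ∀ h, ¬ r h (Q.star h)
  aer2 : ∀ h k, r h k → r (Q.star h) (Q.star k)
  aer3 : ∀ h k, Q.transverse h k → ¬ r h k
  aer4 : ∀ h k, Q.hypRel r h k → ¬ Q.sameHyp h k →
    (∀ m, Q.hypRel r h m → ¬ Q.separates m h k) →
    ∀ a ∈ Q.orient h, ∀ b ∈ Q.orient k, Q.facing a b → r a b

/-- The strict quotient relation: `[h] < [k]` iff `[h] ≠ [k]`, every pair of
representatives has disjoint hyperplanes, and `h' < k'` for every pair of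
representatives whose hyperplanes are `([ĥ] ∪ [k̂])`-inseparable. -/
def QuotLT (Q : Pocset P) (r : P → P → Prop) (h k : P) : Prop :=
  ¬ r h k ∧
  (∀ h' k', r h h' → r k k' → Q.disjointHyp h' k') ∧
  (∀ h' k', r h h' → r k k' →
    (∀ m, (Q.hypRel r h m ∨ Q.hypRel r k m) → ¬ Q.separates m h' k') → Q.lt h' k')

/-- The quotient relation: `[h] ≤ [k]` iff `[h] = [k]` or `[h] < [k]`. -/
def QuotLE (Q : Pocset P) (r : P → P → Prop) (h k : P) : Prop :=
  r h k ∨ Q.QuotLT r h k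

/-- Transversality of `[ĥ]` and `[k̂]` in the quotient pocset. -/
def QuotTransverse (Q : Pocset P) (r : P → P → Prop) (h k : P) : Prop :=
  ¬ Q.hypRel r h k ∧
  ∀ a ∈ Q.orient h, ∀ b ∈ Q.orient k, ¬ Q.QuotLE r a b ∧ ¬ Q.QuotLE r b a

/-- `[k̂]` separates `[ĥ]` and `[l̂]` in the quotient pocset. -/
def QuotSeparates (Q : Pocset P) (r : P → P → Prop) (k h l : P) : Prop :=
  ∃ a ∈ Q.orient h, ∃ b ∈ Q.orient k, ∃ c ∈ Q.orient l,
    Q.QuotLT r a b ∧ Q.QuotLT r b c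

/-- `[h]` and `[k]` are facing in the quotient pocset: `[h]* < [k]`. -/
def QuotFacing (Q : Pocset P) (r : P → P → Prop) (h k : P) : Prop :=
  Q.QuotLT r (Q.star h) k

/-- An admissible map of pocsets. -/
structure IsAdmissibleMap (Q : Pocset P) (Q' : Pocset P') (f : P → P') : Prop where
  am1 : ∀ h, f (Q.star h) = Q'.star (f h)
  am2 : ∀ h k, Q.transverse h k → Q'.transverse (f h) (f k)
  am3 : ∀ h k, Q.facing h k → Q'.sameHyp (f h) (f k) →
    (∀ m, Q'.sameHyp (f m) (f h) → ¬ Q.separates m h k) → f h = f k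
  am4 : ∀ h' : P', (∀ m : P, ¬ Q'.sameHyp (f m) h') →
    ∃ b ∈ Q'.orient h', ∀ m : P, Q'.compatible b (f m)

/-- An embedding of pocsets: an injective, order-reflecting admissible map. -/
structure IsPocsetEmbedding (Q : Pocset P) (Q' : Pocset P') (f : P → P') : Prop where
  adm : IsAdmissibleMap Q Q' f
  inj : Function.Injective f
  le_reflect : ∀ h k, Q'.le (f h) (f k) → Q.le h k

/-- The equivalence relation `∼_f` induced by a map `f`. -/
def simRel (f : P → P') : P → P → Prop := fun a b => f a = f b

/-- A resolution of pocsets: an admissible map `f` such that `∼_f` is an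
admissible equivalence relation and the induced map `P/∼_f → P'` is an
embedding of pocsets (stated here on representatives: `quot_am2` and
`quot_am3` are admissibility of the induced map, `le_reflect` is
order-reflection; injectivity of the induced map is automatic, and its
properties (AM1) and (AM4) coincide with those of `f`). -/
structure IsResolution (Q : Pocset P) (Q' : Pocset P') (f : P → P') : Prop where
  adm : IsAdmissibleMap Q Q' f
  aer : Q.IsAdmissible (simRel f)
  quot_am2 : ∀ h k, Q.QuotTransverse (simRel f) h k → Q'.transverse (f h) (f k)
  quot_am3 : ∀ h k, Q.QuotFacing (simRel f) h k → Q'.sameHyp (f h) (f k) →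
    (∀ m, Q'.sameHyp (f m) (f h) → ¬ Q.QuotSeparates (simRel f) m h k) → f h = f k
  le_reflect : ∀ h k, Q'.le (f h) (f k) → Q.QuotLE (simRel f) h k

/-- A group `G` acts (without inversion) on the pocset `Q` by order-preserving
bijections commuting with `star`. -/
structure IsGAction (Q : Pocset P) (G : Type w) [Group G] [MulAction G P] : Prop where
  smul_le : ∀ (g : G) (a b : P), Q.le a b → Q.le (g • a) (g • b)
  smul_star : ∀ (g : G) (a : P), g • Q.star a = Q.star (g • a)
  no_inversion : ∀ (g : G) (a : P), g • a ≠ Q.star a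

/-- `G`-equivariance of a map. -/
def Equivariant (G : Type w) [Group G] [MulAction G P] [MulAction G P']
    (f : P → P') : Prop :=
  ∀ (g : G) (a : P), f (g • a) = g • f a

/-- An elementary foldable pair for a resolution `f`: facing halfspaces with
`f h₁ = f h₂`, whose hyperplanes are `f⁻¹(f(ĥ₁))`-inseparable, such that no
pair of distinct `∼_f`-equivalent hyperplanes both separate `ĥ₁` and `ĥ₂`. -/
def ElemFoldable (Q : Pocset P) (Q' : Pocset P') (f : P → P') (h₁ h₂ : P) : Prop :=
  Q.facing h₁ h₂ ∧ f h₁ = f h₂ ∧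
  (∀ m, Q'.sameHyp (f m) (f h₁) → ¬ Q.separates m h₁ h₂) ∧
  (∀ m m', Q'.sameHyp (f m) (f m') → ¬ Q.sameHyp m m' →
    ¬ (Q.separates m h₁ h₂ ∧ Q.separates m' h₁ h₂))

/-- `r` is the smallest `G`-invariant and `star`-invariant equivalence
relation with `h₁ ∼ h₂`. -/
structure IsFoldRel (Q : Pocset P) (G : Type w) [Group G] [MulAction G P]
    (h₁ h₂ : P) (r : P → P → Prop) : Prop where
  equiv : Equivalence r
  ginv : ∀ (g : G) (a b : P), r a b → r (g • a) (g • b)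
  sinv : ∀ a b, r a b → r (Q.star a) (Q.star b)
  base : r h₁ h₂
  min : ∀ s : P → P → Prop, Equivalence s →
    (∀ (g : G) (a b : P), s a b → s (g • a) (g • b)) →
    (∀ a b, s a b → s (Q.star a) (Q.star b)) → s h₁ h₂ →
    ∀ a b, r a b → s a b

/-- `[h₁]`, `[h₂]` is an elementary foldable pair in the quotient pocset
`P/r` for the resolution induced by `f` on `P/r`. -/
def QuotElemFoldable (Q : Pocset P) (Q' : Pocset P') (f : P → P')
    (r : P → P → Prop) (h₁ h₂ : P) : Prop :=
  Q.QuotFacing r h₁ h₂ ∧ f h₁ = f h₂ ∧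
  (∀ m, Q'.sameHyp (f m) (f h₁) → ¬ Q.QuotSeparates r m h₁ h₂) ∧
  (∀ m m', Q'.sameHyp (f m) (f m') → ¬ Q.hypRel r m m' →
    ¬ (Q.QuotSeparates r m h₁ h₂ ∧ Q.QuotSeparates r m' h₁ h₂))

/-- `r'` is (the pullback to `P` of) the smallest `G`-invariant and
`star`-invariant equivalence relation on `P/r` identifying `[h₁] ∼ [h₂]`,
i.e. the smallest `G`-invariant, `star`-invariant equivalence relation on `P`
containing `r` with `h₁ ∼ h₂`. -/
structure IsFoldStepRel (Q : Pocset P) (G : Type w) [Group G] [MulAction G P]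
    (r : P → P → Prop) (h₁ h₂ : P) (r' : P → P → Prop) : Prop where
  equiv : Equivalence r'
  mono : ∀ a b, r a b → r' a b
  ginv : ∀ (g : G) (a b : P), r' a b → r' (g • a) (g • b)
  sinv : ∀ a b, r' a b → r' (Q.star a) (Q.star b)
  base : r' h₁ h₂
  min : ∀ s : P → P → Prop, Equivalence s → (∀ a b, r a b → s a b) →
    (∀ (g : G) (a b : P), s a b → s (g • a) (g • b)) →
    (∀ a b, s a b → s (Q.star a) (Q.star b)) → s h₁ h₂ →
    ∀ a b, r' a b → s a b

/-- A finite folding sequence `P = P₀ ↝ P₁ ↝ ⋯ ↝ Pₙ` for a `G`-equivariant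
resolution `f : P → P'`, encoded by the sequence of equivalence relations
`rs i` on `P` with `Pᵢ = P / rs i`: `rs 0` is equality, every `rs i` refines
`∼_f`, and each step is an elementary fold (of an elementary foldable pair
for the induced resolution `fᵢ : P/rs i → P'`). -/
def IsFoldingSequence (Q : Pocset P) (Q' : Pocset P') (G : Type w) [Group G]
    [MulAction G P] (f : P → P') (n : ℕ)
    (rs : Fin (n + 1) → (P → P → Prop)) : Prop :=
  (∀ a b : P, rs 0 a b ↔ a = b) ∧
  (∀ (i : Fin (n + 1)) (a b : P), rs i a b → f a = f b) ∧
  (∀ i : Fin n, ∃ h₁ h₂ : P,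
    Q.QuotElemFoldable Q' f (rs i.castSucc) h₁ h₂ ∧
    Q.IsFoldStepRel G (rs i.castSucc) h₁ h₂ (rs i.succ))

end Pocset

namespace Pocset

variable {P : Type u} {Q : Pocset P} {r s : P → P → Prop}

/-! ### The strict order -/

theorem lt.trans {a b c : P} (h₁ : Q.lt a b) (h₂ : Q.lt b c) : Q.lt a c :=
  ⟨Q.le_trans h₁.1 h₂.1, fun e => h₁.2 (Q.le_antisymm h₁.1 (e ▸ h₂.1))⟩

theorem lt.star {a b : P} (h : Q.lt a b) : Q.lt (Q.star b) (Q.star a) :=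
  ⟨Q.star_antitone h.1, fun e => h.2 (by rw [← Q.star_star a, ← e, Q.star_star])⟩

theorem lt.star_left {a b : P} (h : Q.lt (Q.star a) b) : Q.lt (Q.star b) a := by
  simpa [Q.star_star] using h.star

theorem lt.star_right {a b : P} (h : Q.lt a (Q.star b)) : Q.lt b (Q.star a) := by
  simpa [Q.star_star] using h.star

theorem lt.of_star {a b : P} (h : Q.lt (Q.star a) (Q.star b)) : Q.lt b a := by
  simpa [Q.star_star] using h.star

theorem lt.asymm {a b : P} (h₁ : Q.lt a b) (h₂ : Q.lt b a) : False :=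
  h₁.2 (Q.le_antisymm h₁.1 h₂.1)

theorem not_lt_of_star_lt {a b : P} (h₁ : Q.lt a b) (h₂ : Q.lt (Q.star a) b) : False :=
  Q.not_star_le _ (h₂.star_left.trans h₁).1

theorem not_lt_of_lt_star {a b : P} (h₁ : Q.lt a b) (h₂ : Q.lt a (Q.star b)) : False :=
  Q.not_le_star _ (h₁.trans h₂.star_right).1

/-- If `x < y`, no other pair of orientations of these hyperplanes is increasing. -/
theorem eq_of_lt_of_lt {x y x' y' : P} (h : Q.lt x y) (hx : x' ∈ Q.orient x)
    (hy : y' ∈ Q.orient y) (h' : Q.lt x' y') : x' = x ∧ y' = y := by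
  rcases hx with rfl | hx <;> rcases hy with rfl | hy
  · exact ⟨rfl, rfl⟩
  · cases hy; exact (not_lt_of_lt_star h h').elim
  · cases hx; exact (not_lt_of_star_lt h h').elim
  · cases hx; cases hy; exact (h.asymm h'.of_star).elim

theorem self_mem_orient (a : P) : a ∈ Q.orient a := Or.inl rfl

theorem star_mem_orient (a : P) : Q.star a ∈ Q.orient a := Or.inr rfl

theorem mem_orient_star {a x : P} (h : x ∈ Q.orient a) : Q.star x ∈ Q.orient a := by
  rcases h with rfl | h
  · exact star_mem_orient _
  · cases h; rw [Q.star_star]; exact self_mem_orient _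

theorem orient_star (a : P) : Q.orient (Q.star a) = Q.orient a := by
  simp [orient, Q.star_star, Set.pair_comm]

theorem orient_eq {a x : P} (h : x ∈ Q.orient a) : Q.orient x = Q.orient a := by
  rcases h with rfl | h
  · rfl
  · cases h; exact orient_star _

theorem sameHyp_iff {a b : P} : Q.sameHyp a b ↔ b ∈ Q.orient a := Iff.rfl

theorem sameHyp_iff_orient_eq {a b : P} : Q.sameHyp a b ↔ Q.orient b = Q.orient a :=
  ⟨orient_eq, fun h => sameHyp_iff.2 (h ▸ self_mem_orient b)⟩

theorem sameHyp.symm {a b : P} (h : Q.sameHyp a b) : Q.sameHyp b a :=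
  sameHyp_iff_orient_eq.2 (sameHyp_iff_orient_eq.1 h).symm

theorem disjointHyp.congr {a b a' b' : P} (h : Q.disjointHyp a b) (ha : a' ∈ Q.orient a)
    (hb : b' ∈ Q.orient b) : Q.disjointHyp a' b' := by
  simpa [disjointHyp, transverse, sameHyp_iff_orient_eq, orient_eq ha, orient_eq hb] using h

theorem transverse.symm {a b : P} (h : Q.transverse a b) : Q.transverse b a :=
  ⟨fun e => h.1 e.symm, fun x hx y hy => (h.2 y hy x hx).symm⟩

theorem disjointHyp.symm {a b : P} (h : Q.disjointHyp a b) : Q.disjointHyp b a :=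
  ⟨fun e => h.1 e.symm, fun t => h.2 t.symm⟩

/-- Disjoint hyperplanes are nested, in one of four ways. -/
theorem disjointHyp.cases {a b : P} (h : Q.disjointHyp a b) :
    Q.lt a b ∨ Q.lt b a ∨ Q.lt (Q.star a) b ∨ Q.lt b (Q.star a) := by
  obtain ⟨hs, ht⟩ := h
  have key : ∃ x ∈ Q.orient a, ∃ y ∈ Q.orient b, Q.le x y ∨ Q.le y x := by
    by_contra! hc
    exact ht ⟨hs, hc⟩
  have upgrade : ∃ x ∈ Q.orient a, Q.le x b ∨ Q.le b x := by
    obtain ⟨x, hx, y, rfl | hy, hxy⟩ := key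
    · exact ⟨x, hx, hxy⟩
    · cases hy
      refine ⟨Q.star x, mem_orient_star hx, ?_⟩
      rcases hxy with h | h
      · right; simpa [Q.star_star] using Q.star_antitone h
      · left; simpa [Q.star_star] using Q.star_antitone h
  have hne : ∀ x ∈ Q.orient a, x ≠ b := fun x hx e => hs (e ▸ hx)
  obtain ⟨x, hx, hxb⟩ := upgrade
  have hxne := hne x hx
  rcases hx with rfl | hx
  · rcases hxb with h | h
    · exact Or.inl ⟨h, hxne⟩
    · exact Or.inr (Or.inl ⟨h, hxne.symm⟩)
  · cases hx
    rcases hxb with h | h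
    · exact Or.inr (Or.inr (Or.inl ⟨h, hxne⟩))
    · exact Or.inr (Or.inr (Or.inr ⟨h, hxne.symm⟩))

theorem disjointHyp.exists_lt {a b : P} (h : Q.disjointHyp a b) :
    ∃ x ∈ Q.orient a, Q.lt x b ∨ Q.lt b x := by
  rcases h.cases with h | h | h | h
  · exact ⟨a, self_mem_orient a, Or.inl h⟩
  · exact ⟨a, self_mem_orient a, Or.inr h⟩
  · exact ⟨_, star_mem_orient a, Or.inl h⟩
  · exact ⟨_, star_mem_orient a, Or.inr h⟩

/-! ### Separation -/

theorem separates.symm {m a b : P} (h : Q.separates m a b) : Q.separates m b a := by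
  obtain ⟨x, hx, y, hy, z, hz, h₁, h₂⟩ := h
  exact ⟨_, mem_orient_star hz, _, mem_orient_star hy, _, mem_orient_star hx, h₂.star, h₁.star⟩

theorem separates.congr {m a b m' a' b' : P} (h : Q.separates m a b) (hm : m' ∈ Q.orient m)
    (ha : a' ∈ Q.orient a) (hb : b' ∈ Q.orient b) : Q.separates m' a' b' := by
  simpa [separates, orient_eq hm, orient_eq ha, orient_eq hb] using h

theorem separates.of_lt {x m y : P} (h₁ : Q.lt x m) (h₂ : Q.lt m y) : Q.separates m x y :=
  ⟨x, self_mem_orient x, m, self_mem_orient m, y, self_mem_orient y, h₁, h₂⟩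

theorem separates.exists_between {m x y : P} (h : Q.separates m x y) (hxy : Q.lt x y) :
    ∃ n ∈ Q.orient m, Q.lt x n ∧ Q.lt n y := by
  obtain ⟨x', hx, n, hn, y', hy, h₁, h₂⟩ := h
  obtain ⟨rfl, rfl⟩ := eq_of_lt_of_lt hxy hx hy (h₁.trans h₂)
  exact ⟨n, hn, h₁, h₂⟩

theorem not_separates_self (m a : P) : ¬ Q.separates m a a := by
  rintro ⟨p, hp, n, hn, q, hq, h₁, h₂⟩
  have hpq := h₁.trans h₂
  rw [← orient_eq hp] at hq
  rcases hq with rfl | hq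
  · exact hpq.2 rfl
  · cases hq; exact Q.not_le_star _ hpq.1

theorem separates.split {m a b c : P} (h : Q.separates m a c) (hb : Q.disjointHyp m b) :
    Q.separates m a b ∨ Q.separates m b c := by
  obtain ⟨x, hx, n, hn, z, hz, h₁, h₂⟩ := h
  obtain ⟨y, hy, h | h⟩ := (hb.symm.congr (self_mem_orient b) hn).exists_lt
  · exact Or.inr ⟨y, hy, n, hn, z, hz, h, h₂⟩
  · exact Or.inl ⟨x, hx, n, hn, y, hy, h₁, h⟩

/-! ### Local finiteness -/

theorem LocallyFinite.ncard_lt (hLF : Q.LocallyFinite) {a b c d : P} (hab : Q.le a b)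
    (hbc : Q.le b c) (hcd : Q.le c d) (hne : a ≠ b ∨ c ≠ d) :
    {l | Q.le b l ∧ Q.le l c}.ncard < {l | Q.le a l ∧ Q.le l d}.ncard := by
  refine Set.ncard_lt_ncard ⟨fun l hl => ⟨Q.le_trans hab hl.1, Q.le_trans hl.2 hcd⟩, fun hs => ?_⟩
    (hLF a d)
  rcases hne with hne | hne
  · exact hne (Q.le_antisymm hab
      (hs ⟨Q.le_refl a, Q.le_trans hab (Q.le_trans hbc hcd)⟩).1)
  · exact hne (Q.le_antisymm hcd
      (hs ⟨Q.le_trans hab (Q.le_trans hbc hcd), Q.le_refl d⟩).2)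

/-- Above `x`, the elements below `y` with a given property contain one closest to `x`. -/
theorem LocallyFinite.exists_first (hLF : Q.LocallyFinite) {x y : P} {C : P → Prop}
    (hxy : Q.lt x y) (hy : C y) :
    ∃ z, Q.lt x z ∧ Q.le z y ∧ C z ∧ ∀ n, Q.lt x n → Q.lt n z → ¬ C n := by
  have hfin : {l | Q.lt x l ∧ Q.le l y ∧ C l}.Finite :=
    (hLF x y).subset fun l hl => ⟨hl.1.1, hl.2.1⟩
  obtain ⟨z, hz, hmin⟩ := Set.exists_min_image _ (fun l => {t | Q.le x t ∧ Q.le t l}.ncard) hfin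
    ⟨y, hxy, Q.le_refl y, hy⟩
  refine ⟨z, hz.1, hz.2.1, hz.2.2, fun n h₁ h₂ hn => ?_⟩
  exact (hmin n ⟨h₁, Q.le_trans h₂.1 hz.2.1, hn⟩).not_gt
    (hLF.ncard_lt (Q.le_refl x) h₁.1 h₂.1 (Or.inr h₂.2))

theorem LocallyFinite.exists_last (hLF : Q.LocallyFinite) {x y : P} {C : P → Prop}
    (hxy : Q.lt x y) (hx : C x) :
    ∃ z, Q.le x z ∧ Q.lt z y ∧ C z ∧ ∀ n, Q.lt z n → Q.lt n y → ¬ C n := by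
  obtain ⟨z, h₁, h₂, h₃, h₄⟩ := hLF.exists_first (C := fun l => C (Q.star l)) hxy.star
    (by simpa [Q.star_star] using hx)
  refine ⟨Q.star z, ?_, h₁.star_left, h₃, fun n hn hn' hC => ?_⟩
  · simpa [Q.star_star] using Q.star_antitone h₂
  · exact h₄ (Q.star n) hn'.star hn.star_left (by simpa [Q.star_star] using hC)

/-! ### Star-invariant equivalence relations -/

/-- An equivalence relation compatible with the involution. -/
structure StarEquiv (Q : Pocset P) (r : P → P → Prop) : Prop where
  equiv : Equivalence r
  star : ∀ a b, r a b → r (Q.star a) (Q.star b)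

namespace StarEquiv

theorem star_left (hr : Q.StarEquiv r) {a b : P} (h : r (Q.star a) b) : r a (Q.star b) := by
  simpa [Q.star_star] using hr.star _ _ h

theorem star_right (hr : Q.StarEquiv r) {a b : P} (h : r a (Q.star b)) : r (Q.star a) b := by
  simpa [Q.star_star] using hr.star _ _ h

theorem hyp_refl (hr : Q.StarEquiv r) (a : P) : Q.hypRel r a a := Or.inl (hr.equiv.refl a)

theorem hyp_symm (hr : Q.StarEquiv r) {a b : P} (h : Q.hypRel r a b) : Q.hypRel r b a := by
  rcases h with h | h
  · exact Or.inl (hr.equiv.symm h)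
  · exact Or.inr (hr.equiv.symm (hr.star_right h))

theorem hyp_star_right (_hr : Q.StarEquiv r) {a b : P} (h : Q.hypRel r a b) :
    Q.hypRel r a (Q.star b) := by
  rcases h with h | h
  · exact Or.inr (by rwa [Q.star_star])
  · exact Or.inl h

theorem hyp_star_left (hr : Q.StarEquiv r) {a b : P} (h : Q.hypRel r a b) :
    Q.hypRel r (Q.star a) b :=
  hr.hyp_symm (hr.hyp_star_right (hr.hyp_symm h))

theorem hyp_trans (hr : Q.StarEquiv r) {a b c : P} (h₁ : Q.hypRel r a b)
    (h₂ : Q.hypRel r b c) : Q.hypRel r a c := by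
  rcases h₂ with h₂ | h₂
  · rcases h₁ with h₁ | h₁
    · exact Or.inl (hr.equiv.trans h₁ h₂)
    · exact Or.inr (hr.equiv.trans h₁ (hr.star _ _ h₂))
  · rcases h₁ with h₁ | h₁
    · exact Or.inr (hr.equiv.trans h₁ h₂)
    · exact Or.inl (hr.equiv.trans h₁ (hr.equiv.symm (hr.star_left (hr.equiv.symm h₂))))

theorem hyp_of_mem (hr : Q.StarEquiv r) {a b : P} (h : b ∈ Q.orient a) : Q.hypRel r a b := by
  rcases h with rfl | h
  · exact hr.hyp_refl _
  · cases h; exact hr.hyp_star_right (hr.hyp_refl _)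

end StarEquiv

theorem IsAdmissible.starEquiv (hs : Q.IsAdmissible s) : Q.StarEquiv s := ⟨hs.equiv, hs.aer2⟩

theorem IsAdmissible.disjointHyp (hs : Q.IsAdmissible s) {a b : P} (h : Q.hypRel s a b)
    (hne : ¬ Q.sameHyp a b) : Q.disjointHyp a b := by
  refine ⟨hne, fun ht => ?_⟩
  rcases h with h | h
  · exact hs.aer3 _ _ ht h
  · refine hs.aer3 a (Q.star b) ?_ h
    simpa [transverse, sameHyp_iff_orient_eq, orient_star] using ht

/-! ### The quotient order -/

theorem QuotLT.star (hr : Q.StarEquiv r) {a b : P} (h : Q.QuotLT r a b) :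
    Q.QuotLT r (Q.star b) (Q.star a) := by
  obtain ⟨h₁, h₂, h₃⟩ := h
  refine ⟨fun h => h₁ ?_, fun p q hp hq => ?_, fun p q hp hq hm => ?_⟩
  · simpa [Q.star_star] using hr.equiv.symm (hr.star _ _ h)
  · exact ((h₂ _ _ (hr.star_left hq) (hr.star_left hp)).congr
      (mem_orient_star (self_mem_orient _)) (mem_orient_star (self_mem_orient _))).symm.congr
      (by rw [Q.star_star]; exact self_mem_orient _) (by rw [Q.star_star]; exact self_mem_orient _)
  · refine (h₃ _ _ (hr.star_left hq) (hr.star_left hp) fun m hm' hsep => hm m ?_ ?_).of_star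
    · rcases hm' with hm' | hm'
      · exact Or.inr (hr.hyp_star_left hm')
      · exact Or.inl (hr.hyp_star_left hm')
    · exact (hsep.congr (self_mem_orient _) (mem_orient_star (self_mem_orient _))
        (mem_orient_star (self_mem_orient _))).symm.congr (self_mem_orient _)
        (by rw [Q.star_star]; exact self_mem_orient _)
        (by rw [Q.star_star]; exact self_mem_orient _)

/-- The hyperplanes of `[b]` nearest to `[a]` are crossed in the direction of `b`. -/
theorem QuotLT.rel_of_first (hr : Q.StarEquiv r) (hLF : Q.LocallyFinite) {a b x y : P}
    (h : Q.QuotLT r a b) (hx : Q.hypRel r a x) (hy : Q.hypRel r b y) (hxy : Q.lt x y)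
    (hfirst : ∀ n, Q.lt x n → Q.lt n y → ¬ Q.hypRel r b n) : r b y := by
  obtain ⟨z, hxz, hzy, hz, hlast⟩ := hLF.exists_last (C := Q.hypRel r a) hxy hx
  have hinsep : ∀ z' ∈ Q.orient z, ∀ y' ∈ Q.orient y, ∀ m,
      (Q.hypRel r a m ∨ Q.hypRel r b m) → ¬ Q.separates m z' y' := by
    intro z' hz' y' hy' m hm hsep
    obtain ⟨n, hn, h₁, h₂⟩ := (hsep.congr (self_mem_orient m) (orient_eq hz' ▸ self_mem_orient z)
      (orient_eq hy' ▸ self_mem_orient y)).exists_between hzy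
    have hmn := hr.hyp_of_mem hn
    rcases hm with hm | hm
    · exact hlast n h₁ h₂ (hr.hyp_trans hm hmn)
    · have hxn : Q.lt x n := ⟨Q.le_trans hxz h₁.1, fun e =>
        h₁.2 (Q.le_antisymm h₁.1 (e ▸ hxz))⟩
      exact hfirst n hxn h₂ (hr.hyp_trans hm hmn)
  rcases hy with hy | hy
  · exact hy
  · rcases hz with hz | hz
    · exact (not_lt_of_lt_star hzy (h.2.2 _ _ hz hy (hinsep _ (self_mem_orient _) _
        (star_mem_orient _)))).elim
    · exact (hzy.asymm (h.2.2 _ _ hz hy (hinsep _ (star_mem_orient _) _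
        (star_mem_orient _))).of_star).elim

/-- A class of hyperplanes separating `[b]` and `[c]` in the quotient has a representative
separating `b` and `c`. -/
theorem QuotSeparates.exists_separates (hr : Q.StarEquiv r) (haer1 : ∀ a, ¬ r a (Q.star a))
    (hLF : Q.LocallyFinite) {m b c : P} (h : Q.QuotSeparates r m b c) :
    ∃ n, Q.hypRel r m n ∧ Q.separates n b c := by
  by_contra! hno
  obtain ⟨a, ha, μ, hμ, d, hd, h₁, h₂⟩ := h
  have hmμ := hr.hyp_of_mem hμ
  have hno' : ∀ n, Q.hypRel r μ n → ∀ a' ∈ Q.orient a, ∀ d' ∈ Q.orient d,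
      ¬ Q.separates n a' d' := fun n hn a' ha' d' hd' hsep =>
    hno n (hr.hyp_trans hmμ hn) (hsep.congr (self_mem_orient n)
      (by rw [orient_eq ha', orient_eq ha]; exact self_mem_orient b)
      (by rw [orient_eq hd', orient_eq hd]; exact self_mem_orient c))
  have hda : ∀ n, Q.hypRel r μ n → Q.disjointHyp a n := by
    rintro n (hn | hn)
    · exact h₁.2.1 _ _ (hr.equiv.refl a) hn
    · exact (h₁.2.1 _ _ (hr.equiv.refl a) hn).congr (self_mem_orient a)
        (by rw [orient_star]; exact self_mem_orient n)
  have hdd : ∀ n, Q.hypRel r μ n → Q.disjointHyp d n := by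
    rintro n (hn | hn)
    · exact (h₂.2.1 _ _ hn (hr.equiv.refl d)).symm
    · exact (h₂.2.1 _ _ hn (hr.equiv.refl d)).symm.congr (self_mem_orient d)
        (by rw [orient_star]; exact self_mem_orient n)
  obtain ⟨x, hx, y₀, hy₀, hxy₀⟩ : ∃ x ∈ Q.orient a, ∃ y ∈ Q.orient μ, Q.lt x y := by
    obtain ⟨x, hx, h | h⟩ := (hda μ (hr.hyp_refl μ)).exists_lt
    · exact ⟨x, hx, μ, self_mem_orient μ, h⟩
    · exact ⟨_, mem_orient_star hx, _, star_mem_orient μ, h.star⟩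
  obtain ⟨y, hxy, -, hy, hfirst⟩ := hLF.exists_first (C := Q.hypRel r μ) hxy₀ (hr.hyp_of_mem hy₀)
  have hμy : r μ y := h₁.rel_of_first hr hLF (hr.hyp_of_mem hx) hy hxy hfirst
  obtain ⟨z, hz, hzy | hyz⟩ := (hdd y hy).exists_lt
  swap
  · exact hno' y hy x hx z hz (.of_lt hxy hyz)
  have hμy' : r (Q.star μ) y := by
    refine (h₂.star hr).rel_of_first hr hLF (hr.hyp_star_left (hr.hyp_of_mem hz))
      (hr.hyp_star_left hy) hzy fun n hzn hny hn => ?_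
    have hn' : Q.hypRel r μ n := by simpa [Q.star_star] using hr.hyp_star_left hn
    obtain ⟨x', hx', hxn | hnx⟩ := (hda n hn').exists_lt
    · have := (eq_of_lt_of_lt hxy (orient_eq hx ▸ hx') (self_mem_orient y) (hxn.trans hny)).1
      subst this
      exact hfirst n hxn hny hn'
    · exact hno' n hn' x' hx' z hz (separates.of_lt hzn hnx).symm
  exact haer1 μ (hr.equiv.trans hμy (hr.equiv.symm hμy'))

/-! ### Convex refinements of an admissible relation -/

/-- A refinement `r` of `s` is convex if every hyperplane of an `s`-class separating two
`r`-equivalent members of this class lies in their `r`-class. -/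
structure IsConvexRefinement (Q : Pocset P) (s r : P → P → Prop) : Prop where
  starEquiv : Q.StarEquiv r
  le : ∀ a b, r a b → s a b
  convex : ∀ a b m, r a b → Q.hypRel s a m → Q.separates m a b → Q.hypRel r a m

namespace IsConvexRefinement

theorem hyp_le (h : Q.IsConvexRefinement s r) {a b : P} (hab : Q.hypRel r a b) :
    Q.hypRel s a b :=
  hab.imp (h.le _ _) (h.le _ _)

theorem hyp_convex (h : Q.IsConvexRefinement s r) {a b m : P} (hab : Q.hypRel r a b)
    (ham : Q.hypRel s a m) (hsep : Q.separates m a b) : Q.hypRel r a m := by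
  rcases hab with hab | hab
  · exact h.convex a b m hab ham hsep
  · exact h.convex a _ m hab ham (hsep.congr (self_mem_orient m) (self_mem_orient a)
      (star_mem_orient b))

theorem rel_of_facing (hs : Q.IsAdmissible s) (h : Q.IsConvexRefinement s r) {a b : P}
    (hab : Q.hypRel r a b) (hins : ∀ n, Q.hypRel r a n → ¬ Q.separates n a b)
    (hf : Q.lt (Q.star a) b) : r a b := by
  have hne : ¬ Q.sameHyp a b := by
    rintro (rfl | e)
    · exact Q.not_star_le _ hf.1
    · exact hf.2 e.symm
  have hsab : s a b := hs.aer4 a b (h.hyp_le hab) hne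
    (fun m hm hsep => hins m (h.hyp_convex hab hm hsep) hsep)
    a (self_mem_orient a) b (self_mem_orient b) hf
  rcases hab with hab | hab
  · exact hab
  · exact (hs.aer1 b (hs.equiv.trans (hs.equiv.symm hsab) (h.le _ _ hab))).elim

theorem rel_of_inseparable (hs : Q.IsAdmissible s) (h : Q.IsConvexRefinement s r) {b c x z : P}
    (hbc : Q.lt b c) (hsbc : Q.hypRel s b c) (hrbc : ¬ Q.hypRel r b c)
    (hins : ∀ n, Q.hypRel s b n → ¬ Q.separates n b c)
    (hx : Q.hypRel r b x) (hz : Q.hypRel r c z) (hxz : Q.lt x z)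
    (hins' : ∀ n, (Q.hypRel r b n ∨ Q.hypRel r c n) → ¬ Q.separates n x z) : r b x := by
  have hr := h.starEquiv
  have hS := hs.starEquiv
  have hcross : ∀ n, Q.hypRel r b n → ¬ Q.separates n c z := fun n hn hsep =>
    hrbc (hr.hyp_trans hn (hr.hyp_symm
      (h.hyp_convex hz (hS.hyp_trans (hS.hyp_symm hsbc) (h.hyp_le hn)) hsep)))
  have hzb : ¬ Q.lt z b := fun hlt => hcross b (hr.hyp_refl b) (separates.of_lt hlt hbc).symm
  have hzb' : ¬ Q.lt (Q.star z) b := fun hlt => hcross b (hr.hyp_refl b)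
    ((separates.of_lt hlt hbc).symm.congr (self_mem_orient b) (self_mem_orient c)
      (by rw [orient_star]; exact self_mem_orient z))
  by_cases hne : Q.sameHyp b x
  · rcases hne with rfl | rfl
    · exact hr.equiv.refl _
    · exact (hzb' hxz.star_left).elim
  have hxc : Q.disjointHyp c x := by
    refine hs.disjointHyp (hS.hyp_trans (hS.hyp_symm hsbc) (h.hyp_le hx)) fun hcx => hrbc ?_
    exact hr.hyp_trans hx (hr.hyp_symm (hr.hyp_of_mem hcx))
  have hbz : Q.disjointHyp z b := by
    refine (hs.disjointHyp (hS.hyp_trans hsbc (h.hyp_le hz)) fun hbz => hrbc ?_).symm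
    exact hr.hyp_trans (hr.hyp_of_mem hbz) (hr.hyp_symm hz)
  rcases (hs.disjointHyp (h.hyp_le hx) hne).cases with h1 | h1 | h1 | h1
  · exfalso
    rcases hxc.cases with h2 | h2 | h2 | h2
    · exact hcross x hx (separates.of_lt h2 hxz)
    · exact hins x (h.hyp_le hx) (.of_lt h1 h2)
    · exact hcross x hx ((separates.of_lt h2 hxz).congr (self_mem_orient _)
        (by rw [orient_star]; exact self_mem_orient c) (self_mem_orient _))
    · exact not_lt_of_lt_star hbc (h1.trans h2)
  · exfalso
    rcases hbz.cases with h2 | h2 | h2 | h2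
    · exact hzb h2
    · exact hins' b (Or.inl (hr.hyp_refl b)) (.of_lt h1 h2)
    · exact hzb' h2
    · exact not_lt_of_lt_star hxz (h1.trans h2)
  · exact (hzb' (hxz.star.trans h1.star_left)).elim
  · have hrel : r (Q.star b) (Q.star x) := by
      refine h.rel_of_facing hs (hr.hyp_star_left (hr.hyp_star_right hx)) (fun n hn hsep => ?_)
        (by rw [Q.star_star]; exact h1.star_right)
      replace hn : Q.hypRel r b n := by simpa [Q.star_star] using hr.hyp_star_left hn
      replace hsep : Q.separates n b x := hsep.congr (self_mem_orient n)
        (by rw [orient_star]; exact self_mem_orient b)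
        (by rw [orient_star]; exact self_mem_orient x)
      have hnc : Q.disjointHyp n c := by
        refine hs.disjointHyp (hS.hyp_trans (hS.hyp_symm (h.hyp_le hn)) hsbc) fun hnc => hrbc ?_
        exact hr.hyp_trans hn (hr.hyp_of_mem hnc)
      have hnz : Q.disjointHyp n z := by
        refine hs.disjointHyp (hS.hyp_trans (hS.hyp_symm (h.hyp_le hn))
          (hS.hyp_trans hsbc (h.hyp_le hz))) fun hnz => hrbc ?_
        exact hr.hyp_trans hn (hr.hyp_trans (hr.hyp_of_mem hnz) (hr.hyp_symm hz))
      rcases hsep.split hnc with hsep | hsep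
      · exact hins n (h.hyp_le hn) hsep
      rcases hsep.split hnz with hsep | hsep
      · exact hcross n hn hsep
      · exact hins' n (Or.inl hn) hsep.symm
    simpa [Q.star_star] using hr.star _ _ hrel

theorem quotLT (hs : Q.IsAdmissible s) (h : Q.IsConvexRefinement s r) {b c : P}
    (hbc : Q.lt b c) (hsbc : Q.hypRel s b c) (hrbc : ¬ Q.hypRel r b c)
    (hins : ∀ n, Q.hypRel s b n → ¬ Q.separates n b c) : Q.QuotLT r b c := by
  have hr := h.starEquiv
  have hS := hs.starEquiv
  have hdisj : ∀ p q, r b p → r c q → Q.disjointHyp p q := fun p q hp hq =>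
    hs.disjointHyp (hS.hyp_trans (hS.hyp_symm (Or.inl (h.le _ _ hp)))
      (hS.hyp_trans hsbc (Or.inl (h.le _ _ hq)))) fun hpq =>
      hrbc (hr.hyp_trans (Or.inl hp) (hr.hyp_trans (hr.hyp_of_mem hpq)
        (hr.hyp_symm (Or.inl hq))))
  have hgate : ∀ x z, Q.hypRel r b x → Q.hypRel r c z → Q.lt x z →
      (∀ n, (Q.hypRel r b n ∨ Q.hypRel r c n) → ¬ Q.separates n x z) → r b x ∧ r c z := by
    intro x z hx hz hxz hins'
    refine ⟨h.rel_of_inseparable hs hbc hsbc hrbc hins hx hz hxz hins', ?_⟩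
    have := h.rel_of_inseparable hs hbc.star
      (hS.hyp_star_left (hS.hyp_star_right (hS.hyp_symm hsbc)))
      (fun hcb => hrbc (by
        simpa [Q.star_star] using hr.hyp_star_left (hr.hyp_star_right (hr.hyp_symm hcb))))
      (fun n hn hsep => hins n
        (hS.hyp_trans hsbc (by simpa [Q.star_star] using hS.hyp_star_left hn))
        (hsep.symm.congr (self_mem_orient n) (by rw [orient_star]; exact self_mem_orient b)
          (by rw [orient_star]; exact self_mem_orient c)))
      (hr.hyp_star_left (hr.hyp_star_right hz)) (hr.hyp_star_left (hr.hyp_star_right hx))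
      hxz.star
      (fun n hn hsep => hins' n
        (hn.symm.imp (fun hn => by simpa [Q.star_star] using hr.hyp_star_left hn)
          (fun hn => by simpa [Q.star_star] using hr.hyp_star_left hn))
        (hsep.symm.congr (self_mem_orient n) (by rw [orient_star]; exact self_mem_orient x)
          (by rw [orient_star]; exact self_mem_orient z)))
    simpa [Q.star_star] using hr.star _ _ this
  have hflip : ∀ a p, r a p → ¬ r a (Q.star p) := fun a p h₁ h₂ =>
    hs.aer1 p (h.le _ _ (hr.equiv.trans (hr.equiv.symm h₁) h₂))
  refine ⟨fun h => hrbc (Or.inl h), hdisj, fun p q hp hq hins' => ?_⟩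
  have hins'' : ∀ p' ∈ Q.orient p, ∀ q' ∈ Q.orient q, ∀ n,
      (Q.hypRel r b n ∨ Q.hypRel r c n) → ¬ Q.separates n p' q' := fun p' hp' q' hq' n hn hsep =>
    hins' n hn (hsep.congr (self_mem_orient n) (orient_eq hp' ▸ self_mem_orient p)
      (orient_eq hq' ▸ self_mem_orient q))
  have hpp := hr.hyp_star_right (Or.inl hp)
  have hqq := hr.hyp_star_right (Or.inl hq)
  rcases (hdisj p q hp hq).cases with h1 | h1 | h1 | h1
  · exact h1
  · exact (hflip _ _ hp (hgate _ _ hpp hqq h1.star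
      (hins'' _ (star_mem_orient p) _ (star_mem_orient q))).1).elim
  · exact (hflip _ _ hp (hgate _ _ hpp (Or.inl hq) h1
      (hins'' _ (star_mem_orient p) _ (self_mem_orient q))).1).elim
  · exact (hflip _ _ hq (hgate _ _ (Or.inl hp) hqq h1.star_right
      (hins'' _ (self_mem_orient p) _ (star_mem_orient q))).2).elim

end IsConvexRefinement

/-! ### Equivariant folds -/

section Fold

variable {G : Type w} [Group G] [MulAction G P]

theorem IsGAction.smul_lt (hG : Q.IsGAction G) (g : G) {a b : P} (h : Q.lt a b) :
    Q.lt (g • a) (g • b) :=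
  ⟨hG.smul_le g a b h.1, fun e => h.2 (MulAction.injective g e)⟩

theorem IsGAction.smul_mem_orient (hG : Q.IsGAction G) (g : G) {a x : P} (h : x ∈ Q.orient a) :
    g • x ∈ Q.orient (g • a) := by
  rcases h with rfl | h
  · exact self_mem_orient _
  · cases h; rw [hG.smul_star]; exact star_mem_orient _

theorem IsGAction.smul_separates (hG : Q.IsGAction G) (g : G) {m a b : P}
    (h : Q.separates m a b) : Q.separates (g • m) (g • a) (g • b) := by
  obtain ⟨x, hx, n, hn, y, hy, h₁, h₂⟩ := h
  exact ⟨_, hG.smul_mem_orient g hx, _, hG.smul_mem_orient g hn, _, hG.smul_mem_orient g hy,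
    hG.smul_lt g h₁, hG.smul_lt g h₂⟩

theorem IsGAction.smul_hypRel (hG : Q.IsGAction G) (hrG : ∀ (g : G) a b, r a b → r (g • a) (g • b))
    (g : G) {a b : P} (h : Q.hypRel r a b) : Q.hypRel r (g • a) (g • b) := by
  rcases h with h | h
  · exact Or.inl (hrG g _ _ h)
  · right; rw [← hG.smul_star]; exact hrG g _ _ h

/-- The smallest `G`- and `star`-invariant equivalence relation containing `r` and `(h₁, h₂)`. -/
def foldRel (Q : Pocset P) (G : Type w) [Group G] [MulAction G P] (r : P → P → Prop)
    (h₁ h₂ x y : P) : Prop :=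
  ∀ t : P → P → Prop, Equivalence t → (∀ a b, r a b → t a b) →
    (∀ (g : G) (a b : P), t a b → t (g • a) (g • b)) →
    (∀ a b, t a b → t (Q.star a) (Q.star b)) → t h₁ h₂ → t x y

theorem isFoldStepRel_foldRel (Q : Pocset P) (r : P → P → Prop) (h₁ h₂ : P) :
    Q.IsFoldStepRel G r h₁ h₂ (Q.foldRel G r h₁ h₂) where
  equiv :=
    { refl := fun x _ ht _ _ _ _ => ht.refl x
      symm := fun h t ht h₁ h₂ h₃ h₄ => ht.symm (h t ht h₁ h₂ h₃ h₄)
      trans := fun h h' t ht h₁ h₂ h₃ h₄ => ht.trans (h t ht h₁ h₂ h₃ h₄) (h' t ht h₁ h₂ h₃ h₄) }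
  mono := fun a b h _ _ hr _ _ _ => hr a b h
  ginv := fun g a b h t ht h₁ h₂ h₃ h₄ => h₂ g a b (h t ht h₁ h₂ h₃ h₄)
  sinv := fun a b h t ht h₁ h₂ h₃ h₄ => h₃ a b (h t ht h₁ h₂ h₃ h₄)
  base := fun _ _ _ _ _ h => h
  min := fun _ ht hr hg hs hb _ _ h => h _ ht hr hg hs hb

/-- Folding an `s`-inseparable pair preserves convexity. -/
theorem IsFoldStepRel.isConvexRefinement (hs : Q.IsAdmissible s) (hG : Q.IsGAction G)
    (hsG : ∀ (g : G) a b, s a b → s (g • a) (g • b)) (h : Q.IsConvexRefinement s r)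
    {h₁ h₂ : P} (hbase : s h₁ h₂) (hins : ∀ n, Q.hypRel s h₁ n → ¬ Q.separates n h₁ h₂)
    {r' : P → P → Prop} (hr' : Q.IsFoldStepRel G r h₁ h₂ r') : Q.IsConvexRefinement s r' := by
  have hS := hs.starEquiv
  have hR : Q.StarEquiv r' := ⟨hr'.equiv, hr'.sinv⟩
  have hle := hr'.min s hs.equiv h.le hsG hs.aer2 hbase
  refine ⟨hR, hle, fun a b m hab => ?_⟩
  revert m
  refine (hr'.min (fun x y => r' x y ∧ ∀ m, Q.hypRel s x m → Q.separates m x y →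
    Q.hypRel r' x m) ⟨?_, ?_, ?_⟩ ?_ ?_ ?_ ?_ a b hab).2
  · rintro x
    exact ⟨hr'.equiv.refl x, fun m _ hsep => (not_separates_self m x hsep).elim⟩
  · rintro x y ⟨hxy, hc⟩
    refine ⟨hr'.equiv.symm hxy, fun m hm hsep => ?_⟩
    exact hR.hyp_trans (Or.inl (hr'.equiv.symm hxy))
      (hc m (hS.hyp_trans (Or.inl (hle _ _ hxy)) hm) hsep.symm)
  · rintro x y z ⟨hxy, hc⟩ ⟨hyz, hc'⟩
    refine ⟨hr'.equiv.trans hxy hyz, fun m hm hsep => ?_⟩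
    have hym : Q.hypRel s y m := hS.hyp_trans (Or.inl (hle _ _ (hr'.equiv.symm hxy))) hm
    by_cases hmy : Q.sameHyp y m
    · exact hR.hyp_trans (Or.inl hxy) (hR.hyp_of_mem hmy)
    · rcases hsep.split (hs.disjointHyp hym hmy).symm with hsep | hsep
      · exact hc m hm hsep
      · exact hR.hyp_trans (Or.inl hxy) (hc' m hym hsep)
  · refine fun x y hxy => ⟨hr'.mono _ _ hxy, fun m hm hsep => ?_⟩
    exact (h.convex x y m hxy hm hsep).imp (hr'.mono _ _) (hr'.mono _ _)
  · rintro g x y ⟨hxy, hc⟩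
    refine ⟨hr'.ginv g _ _ hxy, fun m hm hsep => ?_⟩
    have hm' := hG.smul_hypRel hsG g⁻¹ hm
    have hsep' := hG.smul_separates g⁻¹ hsep
    rw [inv_smul_smul] at hm' hsep'
    rw [inv_smul_smul] at hsep'
    simpa using hG.smul_hypRel hr'.ginv g (hc _ hm' hsep')
  · rintro x y ⟨hxy, hc⟩
    refine ⟨hr'.sinv _ _ hxy, fun m hm hsep => hR.hyp_star_left (hc m ?_ ?_)⟩
    · simpa [Q.star_star] using hS.hyp_star_left hm
    · exact hsep.congr (self_mem_orient m) (by rw [orient_star]; exact self_mem_orient x)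
        (by rw [orient_star]; exact self_mem_orient y)
  · exact ⟨hr'.base, fun m hm hsep => (hins m hm hsep).elim⟩

end Fold

/-- Nested hyperplanes between `a` and `c` have comparable orientations. -/
theorem disjointHyp.lt_or_lt {a c x y : P} (h : Q.disjointHyp x y) (hax : Q.lt a x)
    (hxc : Q.lt x c) (hay : Q.lt a y) (hyc : Q.lt y c) : Q.lt x y ∨ Q.lt y x := by
  rcases h.cases with h | h | h | h
  · exact Or.inl h
  · exact Or.inr h
  · exact (not_lt_of_star_lt hxc (h.trans hyc)).elim
  · exact (not_lt_of_lt_star hax (hay.trans h)).elim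

/-- An interval containing `s`-equivalent but not `r`-equivalent hyperplanes contains an
innermost such pair. -/
theorem LocallyFinite.exists_innermost (hLF : Q.LocallyFinite) {x y : P} (hxy : Q.lt x y)
    (hs : Q.hypRel s x y) (hr : ¬ Q.hypRel r x y) :
    ∃ b c, Q.le x b ∧ Q.lt b c ∧ Q.le c y ∧ Q.hypRel s b c ∧ ¬ Q.hypRel r b c ∧
      ∀ p q, Q.le b p → Q.lt p q → Q.le q c → (b ≠ p ∨ q ≠ c) → Q.hypRel s p q →
        Q.hypRel r p q := by
  induction hN : {l | Q.le x l ∧ Q.le l y}.ncard using Nat.strong_induction_on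
    generalizing x y with
  | _ N ih =>
    by_cases hall : ∀ p q, Q.le x p → Q.lt p q → Q.le q y → (x ≠ p ∨ q ≠ y) →
        Q.hypRel s p q → Q.hypRel r p q
    · exact ⟨x, y, Q.le_refl x, hxy, Q.le_refl y, hs, hr, hall⟩
    · push Not at hall
      obtain ⟨p, q, hxp, hpq, hqy, hne, hspq, hrpq⟩ := hall
      obtain ⟨b, c, h₁, h₂, h₃, h₄⟩ :=
        ih _ (hN ▸ hLF.ncard_lt hxp hpq.1 hqy hne) hpq hspq hrpq rfl
      exact ⟨b, c, Q.le_trans hxp h₁, h₂, Q.le_trans h₃ hqy, h₄⟩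

section Resolution

variable {P' : Type v} {Q' : Pocset P'} {f : P → P'}

theorem IsAdmissibleMap.hypRel_iff (hf : IsAdmissibleMap Q Q' f) {a b : P} :
    Q.hypRel (simRel f) a b ↔ Q'.sameHyp (f b) (f a) := by
  simp [hypRel, simRel, sameHyp, hf.am1]

/-- An innermost pair of `f`-equivalent hyperplanes that are not `r`-equivalent is an elementary
foldable pair in the quotient by `r`. -/
theorem IsConvexRefinement.quotElemFoldable (hf : IsAdmissibleMap Q Q' f)
    (hs : Q.IsAdmissible (simRel f)) (h : Q.IsConvexRefinement (simRel f) r)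
    (hLF : Q.LocallyFinite) {b c : P} (hbc : Q.lt b c) (hsbc : Q.hypRel (simRel f) b c)
    (hrbc : ¬ Q.hypRel r b c)
    (hmin : ∀ p q, Q.le b p → Q.lt p q → Q.le q c → (b ≠ p ∨ q ≠ c) →
      Q.hypRel (simRel f) p q → Q.hypRel r p q) :
    Q.QuotElemFoldable Q' f r (Q.star b) c ∧
      ∀ n, Q.hypRel (simRel f) (Q.star b) n → ¬ Q.separates n (Q.star b) c := by
  have hr := h.starEquiv
  have hS := hs.starEquiv
  have hflip : ∀ {n a d : P}, Q.separates n (Q.star a) d → Q.separates n a d := fun hsep =>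
    hsep.congr (self_mem_orient _) (by rw [orient_star]; exact self_mem_orient _)
      (self_mem_orient _)
  have haer1 : ∀ a, ¬ r a (Q.star a) := fun a ha => hs.aer1 a (h.le _ _ ha)
  have hins : ∀ n, Q.hypRel (simRel f) b n → ¬ Q.separates n b c := by
    intro n hn hsep
    obtain ⟨m, hm, h₁, h₂⟩ := hsep.exists_between hbc
    have hsm := hS.hyp_trans hn (hS.hyp_of_mem hm)
    exact hrbc (hr.hyp_trans
      (hmin b m (Q.le_refl b) h₁ h₂.1 (Or.inr h₂.2) hsm)
      (hmin m c h₁.1 h₂ (Q.le_refl c) (Or.inl h₁.2) (hS.hyp_trans (hS.hyp_symm hsm) hsbc)))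
  have hins' : ∀ n, Q.hypRel (simRel f) (Q.star b) n → ¬ Q.separates n (Q.star b) c :=
    fun n hn hsep => hins n (by simpa [Q.star_star] using hS.hyp_star_left hn) (hflip hsep)
  refine ⟨⟨?_, ?_, ?_, ?_⟩, hins'⟩
  · rw [QuotFacing, Q.star_star]
    exact h.quotLT hs hbc hsbc hrbc hins
  · refine hs.aer4 (Q.star b) c (hS.hyp_star_left hsbc) (fun e => hrbc ?_) hins'
      _ (self_mem_orient _) _ (self_mem_orient _) ?_
    · exact hr.hyp_of_mem (by rwa [sameHyp_iff, orient_star] at e)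
    · rw [facing, Q.star_star]; exact hbc
  · intro m hm hsep
    obtain ⟨n, hmn, hn⟩ := hsep.exists_separates hr haer1 hLF
    exact hins' n (hS.hyp_trans (hf.hypRel_iff.2 hm) (h.hyp_le hmn)) hn
  · rintro m m' hmm' hne ⟨hsep, hsep'⟩
    obtain ⟨n, hmn, hn⟩ := hsep.exists_separates hr haer1 hLF
    obtain ⟨n', hmn', hn'⟩ := hsep'.exists_separates hr haer1 hLF
    obtain ⟨k, hk, h₁, h₂⟩ := (hflip hn).exists_between hbc
    obtain ⟨k', hk', h₁', h₂'⟩ := (hflip hn').exists_between hbc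
    have hmk := hr.hyp_trans hmn (hr.hyp_of_mem hk)
    have hmk' := hr.hyp_trans hmn' (hr.hyp_of_mem hk')
    have hskk' : Q.hypRel (simRel f) k k' := hS.hyp_trans (hS.hyp_symm (h.hyp_le hmk))
      (hS.hyp_trans (hS.hyp_symm (hf.hypRel_iff.2 hmm')) (h.hyp_le hmk'))
    have hrkk' : ¬ Q.hypRel r k k' := fun hkk' =>
      hne (hr.hyp_trans hmk (hr.hyp_trans hkk' (hr.hyp_symm hmk')))
    have hd := hs.disjointHyp hskk' fun e => hrkk' (hr.hyp_of_mem e)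
    rcases hd.lt_or_lt h₁ h₂ h₁' h₂' with hlt | hlt
    · exact hrkk' (hmin k k' h₁.1 hlt h₂'.1 (Or.inl h₁.2) hskk')
    · exact hrkk' (hr.hyp_symm (hmin k' k h₁'.1 hlt h₂.1 (Or.inl h₁'.2) (hS.hyp_symm hskk')))

variable {G : Type w} [Group G] [MulAction G P]

/-- Every convex invariant refinement `r` of `∼_f` can be extended, by finitely many elementary
folds, so as to identify two given `f`-equivalent comparable hyperplanes. -/
theorem IsConvexRefinement.exists_folds (hf : IsAdmissibleMap Q Q' f)
    (hs : Q.IsAdmissible (simRel f)) (hLF : Q.LocallyFinite) (hG : Q.IsGAction G)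
    (hsG : ∀ (g : G) a b, simRel f a b → simRel f (g • a) (g • b)) {x y : P} (hxy : Q.lt x y)
    (hsxy : Q.hypRel (simRel f) x y) (h : Q.IsConvexRefinement (simRel f) r) :
    ∃ (n : ℕ) (rs : Fin (n + 1) → (P → P → Prop)), rs 0 = r ∧
      (∀ i, Q.IsConvexRefinement (simRel f) (rs i)) ∧
      (∀ i : Fin n, ∃ h₁ h₂ : P, Q.QuotElemFoldable Q' f (rs i.castSucc) h₁ h₂ ∧
        Q.IsFoldStepRel G (rs i.castSucc) h₁ h₂ (rs i.succ)) ∧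
      Q.hypRel (rs (Fin.last n)) x y := by
  let F : Set P := {l | Q.le x l ∧ Q.le l y}
  have hfin : ∀ r : P → P → Prop, {p : P × P | p ∈ F ×ˢ F ∧ ¬ Q.hypRel r p.1 p.2}.Finite :=
    fun r => ((hLF x y).prod (hLF x y)).subset fun p hp => hp.1
  induction hN : {p : P × P | p ∈ F ×ˢ F ∧ ¬ Q.hypRel r p.1 p.2}.ncard
    using Nat.strong_induction_on generalizing r with
  | _ N ih =>
    by_cases hrxy : Q.hypRel r x y
    · exact ⟨0, fun _ => r, rfl, fun _ => h, fun i => i.elim0, hrxy⟩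
    obtain ⟨b, c, hxb, hbc, hcy, hsbc, hrbc, hmin⟩ := hLF.exists_innermost hxy hsxy hrxy
    obtain ⟨hfold, hins⟩ := h.quotElemFoldable hf hs hLF hbc hsbc hrbc hmin
    have hstep := isFoldStepRel_foldRel (G := G) Q r (Q.star b) c
    have h' := hstep.isConvexRefinement hs hG hsG h hfold.2.1 hins
    have hlt : {p : P × P | p ∈ F ×ˢ F ∧
        ¬ Q.hypRel (Q.foldRel G r (Q.star b) c) p.1 p.2}.ncard < N := by
      rw [← hN]
      refine Set.ncard_lt_ncard ⟨fun p hp => ⟨hp.1, fun hr => hp.2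
        (hr.imp (hstep.mono _ _) (hstep.mono _ _))⟩, fun hsub => ?_⟩ (hfin r)
      have hmem : (b, c) ∈ {p : P × P | p ∈ F ×ˢ F ∧ ¬ Q.hypRel r p.1 p.2} :=
        ⟨⟨⟨hxb, Q.le_trans hbc.1 hcy⟩, ⟨Q.le_trans hxb hbc.1, hcy⟩⟩, hrbc⟩
      exact (hsub hmem).2 (Or.inr (h'.starEquiv.star_left hstep.base))
    obtain ⟨n, rs, h0, hconv, hfolds, hlast⟩ := ih _ hlt h' rfl
    refine ⟨n + 1, Fin.cons r rs, rfl, Fin.cases h hconv, fun i => ?_, ?_⟩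
    · refine Fin.cases ⟨_, _, hfold, ?_⟩ (fun i => ?_) i
      · simpa [h0] using hstep
      · simpa [← Fin.succ_castSucc] using hfolds i
    · simpa [← Fin.succ_last] using hlast

end Resolution

theorem isConvexRefinement_eq (hs : Q.IsAdmissible s) : Q.IsConvexRefinement s Eq where
  starEquiv := ⟨eq_equivalence, fun _ _ e => e ▸ rfl⟩
  le := fun a _ e => e ▸ hs.equiv.refl a
  convex := by
    rintro a _ m rfl - hsep
    exact (not_separates_self m a hsep).elim

end Pocset

/-- two halfspaces with the same image under a `G`-equivariant
resolution can be identified by a finite folding sequence. -/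
theorem folding_two_halfspaces {P : Type u} {P' : Type v}
    (Q : Pocset P) (Q' : Pocset P')
    (hLF : Q.LocallyFinite) (hLF' : Q'.LocallyFinite)
    (G : Type w) [Group G] [MulAction G P] [MulAction G P']
    (hG : Q.IsGAction G) (hG' : Q'.IsGAction G)
    (f : P → P') (hres : Pocset.IsResolution Q Q' f)
    (hequi : Pocset.Equivariant G f)
    (h k : P) (heq : f h = f k) :
    ∃ (n : ℕ) (rs : Fin (n + 1) → (P → P → Prop)),
      Pocset.IsFoldingSequence Q Q' G f n rs ∧ rs (Fin.last n) h k := by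
  have hs := hres.aer
  have hsG : ∀ (g : G) a b, Pocset.simRel f a b → Pocset.simRel f (g • a) (g • b) := by
    intro g a b e
    rw [Pocset.simRel, hequi, hequi, show f a = f b from e]
  have heqv := Pocset.isConvexRefinement_eq hs
  by_cases hne : Q.sameHyp h k
  · refine ⟨0, fun _ => Eq, ⟨fun _ _ => Iff.rfl, fun _ _ _ e => e ▸ rfl, fun i => i.elim0⟩, ?_⟩
    rcases hne with rfl | rfl
    · rfl
    · exact (hs.aer1 h heq).elim
  have key : ∃ x ∈ Q.orient h, ∃ y ∈ Q.orient k, Q.lt x y := by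
    obtain ⟨x, hx, hlt | hlt⟩ := (hs.disjointHyp (Or.inl heq) hne).exists_lt
    · exact ⟨x, hx, k, Pocset.self_mem_orient k, hlt⟩
    · exact ⟨_, Pocset.mem_orient_star hx, _, Pocset.star_mem_orient k, hlt.star⟩
  obtain ⟨x, hx, y, hy, hxy⟩ := key
  have hhyp : ∀ {r : P → P → Prop}, Q.StarEquiv r → (Q.hypRel r x y ↔ Q.hypRel r h k) :=
    fun hr => ⟨fun e => hr.hyp_trans (hr.hyp_of_mem hx)
        (hr.hyp_trans e (hr.hyp_symm (hr.hyp_of_mem hy))),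
      fun e => hr.hyp_trans (hr.hyp_symm (hr.hyp_of_mem hx)) (hr.hyp_trans e (hr.hyp_of_mem hy))⟩
  obtain ⟨n, rs, h0, hconv, hfolds, hlast⟩ := heqv.exists_folds (G := G) hres.adm hs hLF hG hsG hxy
    ((hhyp hs.starEquiv).2 (Or.inl heq))
  refine ⟨n, rs, ⟨fun a b => by rw [h0], fun i => (hconv i).le, hfolds⟩, ?_⟩
  rcases (hhyp (hconv _).starEquiv).1 hlast with hl | hl
  · exact hl
  · exact (hs.aer1 k (heq.symm.trans ((hconv _).le _ _ hl))).elim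
end

section
/- (Thin Simplex Lemma) For all δ ≥ 0, R ≥ 0 and every integer d ≥ 1, there exists R' ≥ 0, depending only on δ, d and R, with the following property: if X is a δ-hyperbolic geodesic metric space and A₁, …, A_d are nonempty R-quasiconvex subsets of X that are pairwise R-coarsely intersecting, then A₁, …, A_d are R'-coarsely intersecting, i.e. the closed R'-neighborhoods of A₁, …, A_d have a common point. -/
universe u

/-- A geodesic from `x` to `y` parametrized by arclength on `[0, dist x y]`. -/
def IsGeodesicParam {X : Type u} [MetricSpace X] (x y : X) (γ : ℝ → X) : Prop :=
  γ 0 = x ∧ γ (dist x y) = y ∧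
    ∀ s ∈ Set.Icc (0 : ℝ) (dist x y), ∀ t ∈ Set.Icc (0 : ℝ) (dist x y),
      dist (γ s) (γ t) = |s - t|

/-- A geodesic metric space: every two points are joined by a geodesic. -/
def IsGeodesicMetricSpace (X : Type u) [MetricSpace X] : Prop :=
  ∀ x y : X, ∃ γ : ℝ → X, IsGeodesicParam x y γ

/-- `δ`-hyperbolicity via the four-point condition on Gromov products
`(x|y)_p = (d(x,p) + d(y,p) − d(x,y))/2`. -/
def IsDeltaHyperbolic (X : Type u) [MetricSpace X] (δ : ℝ) : Prop :=
  ∀ x y z p : X,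
    min ((dist x p + dist y p - dist x y) / 2)
        ((dist y p + dist z p - dist y z) / 2) - δ ≤
      (dist x p + dist z p - dist x z) / 2

/-- `R`-quasiconvexity: every point on every geodesic between two points of
`A` lies at distance at most `R` from `A`. -/
def IsQuasiconvexSet {X : Type u} [MetricSpace X] (R : ℝ) (A : Set X) : Prop :=
  ∀ x ∈ A, ∀ y ∈ A, ∀ γ : ℝ → X, IsGeodesicParam x y γ →
    ∀ t ∈ Set.Icc (0 : ℝ) (dist x y), Metric.infDist (γ t) A ≤ R

section

variable {X : Type u} [MetricSpace X]

/-- In a geodesic space, a quasiconvex set coarsely contains a point at any prescribed admissible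
distance along a geodesic between two of its points. -/
theorem IsQuasiconvexSet.exists_between {R : ℝ} {A : Set X} (hA : IsQuasiconvexSet R A)
    (hX : IsGeodesicMetricSpace X) {x y : X} (hx : x ∈ A) (hy : y ∈ A) {t : ℝ}
    (h0 : 0 ≤ t) (ht : t ≤ dist x y) :
    ∃ m : X, dist x m = t ∧ dist m y = dist x y - t ∧ Metric.infDist m A ≤ R := by
  obtain ⟨γ, hγ⟩ := hX x y
  have hq := hA x hx y hy γ hγ t ⟨h0, ht⟩
  obtain ⟨hγ0, hγ1, hγd⟩ := hγ
  refine ⟨γ t, ?_, ?_, hq⟩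
  · have h := hγd 0 ⟨le_rfl, dist_nonneg⟩ t ⟨h0, ht⟩
    rwa [hγ0, zero_sub, abs_neg, abs_of_nonneg h0] at h
  · have h := hγd t ⟨h0, ht⟩ (dist x y) ⟨dist_nonneg, le_rfl⟩
    rwa [hγ1, abs_sub_comm, abs_of_nonneg (sub_nonneg.2 ht)] at h

/-- Going from `p` to a point `u` of a quasiconvex set through an almost nearest point `a` is
almost shortest. -/
theorem IsQuasiconvexSet.dist_add_dist_le_of_almost_nearest {δ R : ℝ} {A : Set X}
    (hA : IsQuasiconvexSet R A) (hX : IsGeodesicMetricSpace X) (hδX : IsDeltaHyperbolic X δ)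
    {p a u : X} (ha : a ∈ A) (hu : u ∈ A) (hpa : dist p a ≤ Metric.infDist p A + 1) :
    dist p a + dist a u ≤ dist p u + 2 * (2 * δ + R + 1) := by
  obtain ⟨m, ham, hmu, hmA⟩ := hA.exists_between hX ha hu
    (t := (dist p a + dist a u - dist p u) / 2)
    (by linarith [dist_triangle p a u]) (by linarith [dist_triangle p u a, dist_comm u a])
  have hpm : Metric.infDist p A ≤ Metric.infDist m A + dist p m :=
    Metric.infDist_le_infDist_add_dist
  have h := hδX p u m a
  rw [dist_comm u a, dist_comm m a, dist_comm u m] at h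
  rw [min_eq_left (by linarith)] at h
  linarith

/-- If the quasiconvex sets `A` and `B` contain points `u` and `v` at
distance at most `D`, and `B` is not farther from `p` than `A`, then an almost nearest point of `A`
to `p` is close to `B`. -/
theorem infDist_le_of_almost_nearest {δ R D : ℝ} (hδ : 0 ≤ δ) (hR : 0 ≤ R) {A B : Set X}
    (hA : IsQuasiconvexSet R A) (hB : IsQuasiconvexSet R B)
    (hX : IsGeodesicMetricSpace X) (hδX : IsDeltaHyperbolic X δ) {p a u v : X}
    (hBA : Metric.infDist p B ≤ Metric.infDist p A)
    (ha : a ∈ A) (hu : u ∈ A) (hv : v ∈ B) (hpa : dist p a ≤ Metric.infDist p A + 1)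
    (huv : dist u v ≤ D) :
    Metric.infDist a B ≤ 10 * δ + 5 * R + 5 + 4 * D := by
  obtain ⟨b, hb, hpb⟩ := (Metric.infDist_lt_iff ⟨v, hv⟩).1 (lt_add_one (Metric.infDist p B))
  have h1 := hA.dist_add_dist_le_of_almost_nearest hX hδX ha hu hpa
  have h2 := hB.dist_add_dist_le_of_almost_nearest hX hδX hb hv hpb.le
  have hpA := Metric.infDist_le_dist_of_mem (x := p) ha
  have huv0 : 0 ≤ dist u v := dist_nonneg
  have hpv : dist p u ≤ dist p v + dist u v := by
    simpa [dist_comm v u] using dist_triangle p v u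
  have hav := dist_triangle a u v
  have hpbv := dist_triangle p b v
  obtain ⟨s, hs0, hsa, hsb, hs⟩ : ∃ s : ℝ, 0 ≤ s ∧ s ≤ dist a v ∧ s ≤ dist b v ∧
      dist a v - s ≤ 1 + 2 * (2 * δ + R + 1 + D) := by
    refine ⟨min (dist a v) (dist b v), le_min dist_nonneg dist_nonneg, min_le_left _ _,
      min_le_right _ _, ?_⟩
    rcases min_cases (dist a v) (dist b v) with h | h <;> rw [h.1] <;> linarith
  obtain ⟨m, hbm, hmv, hmB⟩ := hB.exists_between hX hb hv (t := dist b v - s)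
    (by linarith) (by linarith)
  have hpm := dist_triangle p b m
  have h := hδX a p m v
  rw [dist_comm a p] at h
  have hmin : s - (2 * δ + R + 1 + D) ≤ min ((dist a v + dist p v - dist p a) / 2)
      ((dist p v + dist m v - dist p m) / 2) := le_min (by linarith) (by linarith)
  have ham : Metric.infDist a B ≤ Metric.infDist m B + dist a m :=
    Metric.infDist_le_infDist_add_dist
  linarith

/-- Coarsely intersecting sets contain points that are close to each other. -/
theorem exists_dist_le_of_cthickening_inter_nonempty {R : ℝ} (hR : 0 ≤ R) {A B : Set X}
    (h : (Metric.cthickening R A ∩ Metric.cthickening R B).Nonempty) :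
    ∃ u ∈ A, ∃ v ∈ B, dist u v ≤ 2 * R + 2 := by
  obtain ⟨y, hyA, hyB⟩ := h
  have hR1 : 0 < R + 1 := by linarith
  obtain ⟨u, hu, hyu⟩ := Metric.mem_thickening_iff.1
    (Metric.cthickening_subset_thickening' hR1 (lt_add_one R) A hyA)
  obtain ⟨v, hv, hyv⟩ := Metric.mem_thickening_iff.1
    (Metric.cthickening_subset_thickening' hR1 (lt_add_one R) B hyB)
  exact ⟨u, hu, v, hv, by linarith [dist_triangle_left u v y]⟩

end

/-- Thin Simplex Lemma: for all `δ, R ≥ 0` and `d ≥ 1` there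
is `R' ≥ 0`, depending only on `δ`, `d`, `R`, such that in any δ-hyperbolic
geodesic metric space, any `d` nonempty pairwise `R`-coarsely intersecting
`R`-quasiconvex subsets are `R'`-coarsely intersecting. -/
theorem thin_simplex_lemma (δ R : ℝ) (hδ : 0 ≤ δ) (hR : 0 ≤ R)
    (d : ℕ) (hd : 1 ≤ d) :
    ∃ R' : ℝ, 0 ≤ R' ∧
      ∀ (X : Type u) [MetricSpace X], IsGeodesicMetricSpace X →
        IsDeltaHyperbolic X δ →
        ∀ A : Fin d → Set X, (∀ i, (A i).Nonempty) →
          (∀ i, IsQuasiconvexSet R (A i)) →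
          (∀ i j : Fin d,
            (Metric.cthickening R (A i) ∩ Metric.cthickening R (A j)).Nonempty) →
          (⋂ i, Metric.cthickening R' (A i)).Nonempty := by
  refine ⟨10 * δ + 13 * R + 13, by positivity, ?_⟩
  intro X _ hX hδX A hne hqc hint
  have : Nonempty (Fin d) := ⟨⟨0, hd⟩⟩
  obtain ⟨p, -⟩ := hne (Classical.arbitrary (Fin d))
  obtain ⟨i, hi⟩ := Finite.exists_max fun i => Metric.infDist p (A i)
  obtain ⟨a, ha, hpa⟩ := (Metric.infDist_lt_iff (hne i)).1 (lt_add_one (Metric.infDist p (A i)))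
  refine ⟨a, Set.mem_iInter.2 fun j => ?_⟩
  obtain ⟨u, hu, v, hv, huv⟩ := exists_dist_le_of_cthickening_inter_nonempty hR (hint i j)
  have h := infDist_le_of_almost_nearest hδ hR (hqc i) (hqc j) hX hδX (hi j) ha hu hv hpa.le huv
  rw [Metric.mem_cthickening_iff, ENNReal.le_ofReal_iff_toReal_le
    (Metric.infEDist_ne_top (hne j)) (by positivity), ← Metric.infDist]
  linarith
end

section
/- Let H be a group with a finite symmetric generating set S whose word metric d_S is δ-hyperbolic for some δ ≥ 0, and let L₁, …, L_r be subgroups of H each of which is R-quasiconvex with respect to d_S for some R ≥ 0. Then for every integer d ≥ 1, the collection of d-element sets {g₁L_{k₁}, …, g_d L_{k_d}} of left cosets (with gᵢ ∈ H and 1 ≤ kᵢ ≤ r) that are pairwise R-coarsely intersecting with respect to d_S decomposes into finitely many orbits under the action of H by left multiplication on cosets. -/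
universe u

/-- The word length of `x` with respect to a generating set `S`. -/
noncomputable def wordLength {H : Type u} [Group H] (S : Set H) (x : H) : ℕ :=
  sInf {n : ℕ | ∃ l : List H, (∀ s ∈ l, s ∈ S) ∧ l.length = n ∧ l.prod = x}

/-- The word metric `d_S(g, h)`. -/
noncomputable def wordDist {H : Type u} [Group H] (S : Set H) (g h : H) : ℕ :=
  wordLength S (g⁻¹ * h)

/-- A discrete geodesic of length `n` with respect to the word metric. -/
def IsDiscreteGeodesic {H : Type u} [Group H] (S : Set H) (n : ℕ)
    (x : ℕ → H) : Prop :=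
  ∀ i ≤ n, ∀ j ≤ n, wordDist S (x i) (x j) = Nat.dist i j

/-- The Gromov product `(x|y)_p` with respect to the word metric. -/
noncomputable def gromovProd {H : Type u} [Group H] (S : Set H) (x y p : H) : ℝ :=
  ((wordDist S x p : ℝ) + (wordDist S y p : ℝ) - (wordDist S x y : ℝ)) / 2

/-- `δ`-hyperbolicity of the word metric via the four-point condition. -/
def IsHyperbolicWordMetric {H : Type u} [Group H] (S : Set H) (δ : ℝ) : Prop :=
  ∀ x y z p : H,
    min (gromovProd S x y p) (gromovProd S y z p) - δ ≤ gromovProd S x z p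

/-- `R`-quasiconvexity of a subgroup with respect to the word metric. -/
def IsQuasiconvexSubgroup {H : Type u} [Group H] (S : Set H) (R : ℝ)
    (L : Subgroup H) : Prop :=
  ∀ a ∈ L, ∀ b ∈ L, ∀ (n : ℕ) (x : ℕ → H), x 0 = a → x n = b →
    IsDiscreteGeodesic S n x →
    ∀ i ≤ n, ∃ l ∈ L, (wordDist S (x i) l : ℝ) ≤ R

/-- Two subsets of `H` are `R`-coarsely intersecting: their closed
`R`-neighborhoods with respect to the word metric meet. -/
def CoarselyIntersect {H : Type u} [Group H] (S : Set H) (R : ℝ)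
    (A B : Set H) : Prop :=
  ∃ z : H, (∃ a ∈ A, (wordDist S z a : ℝ) ≤ R) ∧ (∃ b ∈ B, (wordDist S z b : ℝ) ≤ R)

section WordMetric

variable {H : Type u} [Group H] {S : Set H}

theorem wordLength_prod_le {l : List H} (hl : ∀ s ∈ l, s ∈ S) :
    wordLength S l.prod ≤ l.length :=
  Nat.sInf_le ⟨l, hl, rfl, rfl⟩

theorem exists_list_length_eq_wordLength (hsym : ∀ s ∈ S, s⁻¹ ∈ S)
    (hgen : Subgroup.closure S = ⊤) (x : H) :
    ∃ l : List H, (∀ s ∈ l, s ∈ S) ∧ l.length = wordLength S x ∧ l.prod = x := by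
  have hx : x ∈ Submonoid.closure (S ∪ S⁻¹) := by
    rw [← Subgroup.closure_toSubmonoid, hgen]
    trivial
  obtain ⟨l, hl, hx⟩ := Submonoid.exists_list_of_mem_closure hx
  refine Nat.sInf_mem (s := {n : ℕ | ∃ l : List H, (∀ s ∈ l, s ∈ S) ∧ l.length = n ∧ l.prod = x})
    ⟨l.length, l, fun s hs => ?_, rfl, hx⟩
  rcases hl s hs with h | h
  · exact h
  · simpa using hsym _ h

theorem wordLength_mul_le (hsym : ∀ s ∈ S, s⁻¹ ∈ S) (hgen : Subgroup.closure S = ⊤)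
    (x y : H) : wordLength S (x * y) ≤ wordLength S x + wordLength S y := by
  obtain ⟨l, hl, hlen, rfl⟩ := exists_list_length_eq_wordLength hsym hgen x
  obtain ⟨m, hm, hmlen, rfl⟩ := exists_list_length_eq_wordLength hsym hgen y
  rw [← hlen, ← hmlen, ← List.prod_append, ← List.length_append]
  exact wordLength_prod_le fun s hs => (List.mem_append.1 hs).elim (hl s) (hm s)

theorem wordLength_inv_le (hsym : ∀ s ∈ S, s⁻¹ ∈ S) (hgen : Subgroup.closure S = ⊤)
    (x : H) : wordLength S x⁻¹ ≤ wordLength S x := by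
  obtain ⟨l, hl, hlen, rfl⟩ := exists_list_length_eq_wordLength hsym hgen x
  rw [← hlen, List.prod_inv_reverse]
  refine (wordLength_prod_le fun s hs => ?_).trans_eq (by simp)
  obtain ⟨t, ht, rfl⟩ := List.mem_map.1 (List.mem_reverse.1 hs)
  exact hsym t (hl t ht)

theorem wordDist_comm (hsym : ∀ s ∈ S, s⁻¹ ∈ S) (hgen : Subgroup.closure S = ⊤)
    (x y : H) : wordDist S x y = wordDist S y x := by
  have key (a b : H) : wordDist S a b ≤ wordDist S b a := by
    simpa [wordDist] using wordLength_inv_le hsym hgen (b⁻¹ * a)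
  exact (key x y).antisymm (key y x)

theorem wordDist_triangle (hsym : ∀ s ∈ S, s⁻¹ ∈ S) (hgen : Subgroup.closure S = ⊤)
    (x y z : H) : wordDist S x z ≤ wordDist S x y + wordDist S y z := by
  simpa [wordDist, mul_assoc] using wordLength_mul_le hsym hgen (x⁻¹ * y) (y⁻¹ * z)

theorem wordDist_mul_left (g x y : H) : wordDist S (g * x) (g * y) = wordDist S x y := by
  simp [wordDist, mul_assoc]

theorem finite_setOf_wordLength_le (hS : S.Finite) (hsym : ∀ s ∈ S, s⁻¹ ∈ S)
    (hgen : Subgroup.closure S = ⊤) (n : ℕ) : {x | wordLength S x ≤ n}.Finite := by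
  have : Finite S := hS
  refine ((List.finite_length_le S n).image fun l => (l.map Subtype.val).prod).subset ?_
  intro x hx
  obtain ⟨l, hl, hlen, rfl⟩ := exists_list_length_eq_wordLength hsym hgen x
  lift l to List S using hl
  exact ⟨l, (List.length_map _).symm.trans_le (hlen.trans_le hx), rfl⟩

theorem exists_isDiscreteGeodesic (hsym : ∀ s ∈ S, s⁻¹ ∈ S) (hgen : Subgroup.closure S = ⊤)
    (a b : H) : ∃ x : ℕ → H, x 0 = a ∧ x (wordDist S a b) = b ∧
      IsDiscreteGeodesic S (wordDist S a b) x := by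
  obtain ⟨l, hl, hlen, hprod⟩ := exists_list_length_eq_wordLength hsym hgen (a⁻¹ * b)
  change l.length = wordDist S a b at hlen
  set n := wordDist S a b with hn
  set x : ℕ → H := fun i => a * (l.take i).prod with hx
  have h0 : x 0 = a := by simp [hx]
  have hxn : x n = b := by simp [hx, ← hlen, hprod]
  have hle : ∀ i j, i ≤ j → wordDist S (x i) (x j) ≤ j - i := by
    intro i j hij
    have hsplit : (l.take j).prod = (l.take i).prod * ((l.drop i).take (j - i)).prod := by
      rw [← List.prod_append, ← List.take_add, Nat.add_sub_cancel' hij]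
    have hd : wordDist S (x i) (x j) = wordLength S ((l.drop i).take (j - i)).prod := by
      simp [hx, wordDist, hsplit]
    rw [hd]
    refine (wordLength_prod_le fun s hs => hl s ?_).trans (List.length_take_le _ _)
    exact List.mem_of_mem_drop (List.mem_of_mem_take hs)
  have heq : ∀ i j, i ≤ j → j ≤ n → wordDist S (x i) (x j) = j - i := by
    intro i j hij hjn
    have h1 := hle 0 i (Nat.zero_le i)
    have h2 := hle i j hij
    have h3 := hle j n hjn
    have h4 := wordDist_triangle hsym hgen (x 0) (x i) (x n)
    have h5 := wordDist_triangle hsym hgen (x i) (x j) (x n)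
    rw [h0, hxn, ← hn] at h4
    rw [h0] at h1
    rw [hxn] at h3 h5
    omega
  refine ⟨x, h0, hxn, fun i hi j hj => ?_⟩
  rcases le_total i j with h | h
  · rw [heq i j h hj, Nat.dist_eq_sub_of_le h]
  · rw [wordDist_comm hsym hgen, heq j i h hi, Nat.dist_eq_sub_of_le_right h]

/-- A quasiconvex coset comes as close to a point `q` as the Gromov product at `q` of any two of
its elements, up to an additive constant. -/
theorem exists_mem_coset_wordDist_le (hsym : ∀ s ∈ S, s⁻¹ ∈ S) (hgen : Subgroup.closure S = ⊤)
    {δ R : ℝ} (hhyp : IsHyperbolicWordMetric S δ) {L : Subgroup H}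
    (hL : IsQuasiconvexSubgroup S R L) (g : H) {a b : H} (ha : a ∈ L) (hb : b ∈ L) (q : H) :
    ∃ y ∈ L, (wordDist S q (g * y) : ℝ) ≤
      gromovProd S (g * a) (g * b) q + 1 + 2 * δ + R := by
  obtain ⟨p, rfl⟩ : ∃ p, q = g * p := ⟨g⁻¹ * q, by simp⟩
  simp only [gromovProd, wordDist_mul_left]
  obtain ⟨x, h0, hn, hgeo⟩ := exists_isDiscreteGeodesic hsym hgen a b
  have tri (u v w : H) : (wordDist S u w : ℝ) ≤ wordDist S u v + wordDist S v w := by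
    exact_mod_cast wordDist_triangle hsym hgen u v w
  have comm (u v : H) : (wordDist S u v : ℝ) = wordDist S v u := by
    rw [wordDist_comm hsym hgen]
  have hpos : 0 ≤ gromovProd S p b a := by
    have := tri p a b
    rw [gromovProd]
    linarith [comm a b]
  have hle : gromovProd S p b a ≤ wordDist S a b := by
    have := tri p b a
    rw [gromovProd]
    linarith [comm a b]
  set t := ⌊gromovProd S p b a⌋₊ with ht
  have ht1 : (t : ℝ) ≤ gromovProd S p b a := Nat.floor_le hpos
  have ht2 : gromovProd S p b a < t + 1 := Nat.lt_floor_add_one _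
  have htn : t ≤ wordDist S a b := by exact_mod_cast ht1.trans hle
  obtain ⟨y, hy, hxy⟩ := hL a ha b hb _ x h0 hn hgeo t htn
  have hat : wordDist S (x t) a = t := by
    have := hgeo t htn 0 (Nat.zero_le _)
    rwa [h0, Nat.dist_zero_right] at this
  have htb : (wordDist S (x t) b : ℝ) = wordDist S a b - t := by
    have := hgeo t htn _ le_rfl
    rw [hn, Nat.dist_eq_sub_of_le htn] at this
    rw [this, Nat.cast_sub htn]
  have hbx : gromovProd S b (x t) a = t := by
    rw [gromovProd, hat, comm b (x t), htb, comm b a]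
    ring
  have hfour := hhyp p b (x t) a
  rw [hbx, min_eq_right ht1, gromovProd, hat] at hfour
  refine ⟨y, hy, ?_⟩
  rw [gromovProd] at ht2
  linarith [tri p (x t) y, comm a p, comm b p, comm a b]

/-- Uniform coarse Helly property for cosets of quasiconvex subgroups. -/
theorem exists_wordDist_le_of_coarselyIntersect (hsym : ∀ s ∈ S, s⁻¹ ∈ S)
    (hgen : Subgroup.closure S = ⊤) {δ R : ℝ} (hδ : 0 ≤ δ) (hR : 0 ≤ R)
    (hhyp : IsHyperbolicWordMetric S δ) {ι : Type*} [Finite ι] [Nonempty ι]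
    {L : ι → Subgroup H} (hL : ∀ i, IsQuasiconvexSubgroup S R (L i)) (g : ι → H)
    (hint : ∀ i j, CoarselyIntersect S R ((g i * ·) '' (L i : Set H))
      ((g j * ·) '' (L j : Set H))) :
    ∃ z : H, ∀ i, ∃ y ∈ L i, (wordDist S z (g i * y) : ℝ) ≤ 5 * R + 8 * δ + 3 := by
  have tri (u v w : H) : (wordDist S u w : ℝ) ≤ wordDist S u v + wordDist S v w := by
    exact_mod_cast wordDist_triangle hsym hgen u v w
  have comm (u v : H) : (wordDist S u v : ℝ) = wordDist S v u := by
    rw [wordDist_comm hsym hgen]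
  have hproj (i : ι) : ∃ m ∈ L i, ∀ y ∈ L i, wordDist S 1 (g i * m) ≤ wordDist S 1 (g i * y) := by
    obtain ⟨m, hm⟩ := WellFounded.has_min (measure fun y => wordDist S 1 (g i * y)).wf
      (L i : Set H) ⟨1, one_mem (L i)⟩
    exact ⟨m, hm.1, fun y hy => not_lt.1 (hm.2 y hy)⟩
  choose m hm hmin using hproj
  obtain ⟨i, hi⟩ := Finite.exists_max fun i => wordDist S 1 (g i * m i)
  refine ⟨g i * m i, fun j => ?_⟩
  obtain ⟨z, ⟨_, ⟨a, ha, rfl⟩, hza⟩, ⟨_, ⟨b, hb, rfl⟩, hzb⟩⟩ := hint i j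
  dsimp only at hza hzb
  obtain ⟨y, hy, hpy⟩ := exists_mem_coset_wordDist_le hsym hgen hhyp (hL i) (g i) (hm i) ha 1
  have hmin' : (wordDist S 1 (g i * m i) : ℝ) ≤ wordDist S 1 (g i * y) := by
    exact_mod_cast hmin i y hy
  have hi' : (wordDist S 1 (g j * m j) : ℝ) ≤ wordDist S 1 (g i * m i) := by
    exact_mod_cast hi j
  obtain ⟨w, hw, hqw⟩ :=
    exists_mem_coset_wordDist_le hsym hgen hhyp (hL j) (g j) (hm j) hb (g i * m i)
  refine ⟨w, hw, hqw.trans ?_⟩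
  have hfour := hhyp 1 (g j * m j) z (g i * m i)
  generalize g i * m i = q at *
  generalize g j * m j = s at *
  generalize g i * a = a' at *
  generalize g j * b = b' at *
  simp only [gromovProd] at *
  rcases le_total (((wordDist S 1 q : ℝ) + wordDist S s q - wordDist S 1 s) / 2)
    (((wordDist S s q : ℝ) + wordDist S z q - wordDist S s z) / 2) with h | h
  · rw [min_eq_left h] at hfour
    linarith [tri z a' q, tri 1 z a', comm q 1, comm a' 1, comm q a', tri b' s q, comm b' s]
  · rw [min_eq_right h] at hfour
    linarith [tri z a' q, tri 1 z a', comm z b', comm q 1, comm a' 1, comm q a', tri s b' z,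
      tri b' z q]

end WordMetric

/-- in a hyperbolic group with `R`-quasiconvex subgroups
`L₁, …, L_r`, for every `d ≥ 1` the `d`-element collections of left cosets
of the `L_k` that are pairwise `R`-coarsely intersecting fall into finitely
many orbits under left multiplication by `H`: there is a finite set `T` of
data `(g, k)` such that every pairwise `R`-coarsely intersecting collection
of cosets `(gᵢ L_{kᵢ})` is the left translate by some `h ∈ H` of the
collection of cosets determined by some element of `T`. -/
theorem finitely_many_orbits_of_coarsely_intersecting_cosets
    (H : Type u) [Group H] (S : Finset H)
    (hsym : ∀ s ∈ S, s⁻¹ ∈ S) (hone : (1 : H) ∉ S)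
    (hgen : Subgroup.closure (S : Set H) = ⊤)
    (δ : ℝ) (hδ : 0 ≤ δ) (hhyp : IsHyperbolicWordMetric (S : Set H) δ)
    (R : ℝ) (hR : 0 ≤ R) (r : ℕ) (L : Fin r → Subgroup H)
    (hqc : ∀ i, IsQuasiconvexSubgroup (S : Set H) R (L i))
    (d : ℕ) (hd : 1 ≤ d) :
    ∃ T : Finset ((Fin d → H) × (Fin d → Fin r)),
      ∀ (g : Fin d → H) (k : Fin d → Fin r),
        (∀ i j : Fin d,
          CoarselyIntersect (S : Set H) R
            ((g i * ·) '' (L (k i) : Set H)) ((g j * ·) '' (L (k j) : Set H))) →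
        ∃ h : H, ∃ t ∈ T,
          ∀ i : Fin d,
            (g i * ·) '' (L (k i) : Set H) =
              (h * t.1 i * ·) '' (L (t.2 i) : Set H) := by
  classical
  have hsym' : ∀ s ∈ (S : Set H), s⁻¹ ∈ (S : Set H) := by simpa using hsym
  have : Nonempty (Fin d) := ⟨⟨0, hd⟩⟩
  set N := ⌊5 * R + 8 * δ + 3⌋₊
  have hfin := finite_setOf_wordLength_le S.finite_toSet hsym' hgen N
  refine ⟨Fintype.piFinset (fun _ => hfin.toFinset) ×ˢ Finset.univ, fun g k hint => ?_⟩
  obtain ⟨z, hz⟩ := exists_wordDist_le_of_coarselyIntersect hsym' hgen hδ hR hhyp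
    (fun i => hqc (k i)) g hint
  choose y hy hzy using hz
  refine ⟨z, (fun i => z⁻¹ * (g i * y i), k), ?_, fun i => ?_⟩
  · simp only [Finset.mem_product, Fintype.mem_piFinset, Finset.mem_univ, and_true,
      Set.Finite.mem_toFinset, Set.mem_ofPred_eq]
    exact fun i => Nat.le_floor (hzy i)
  · ext x
    simp only [Set.mem_image, SetLike.mem_coe, mul_inv_cancel_left]
    constructor
    · rintro ⟨l, hl, rfl⟩
      exact ⟨(y i)⁻¹ * l, mul_mem (inv_mem (hy i)) hl, by group⟩
    · rintro ⟨l, hl, rfl⟩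
      exact ⟨y i * l, mul_mem (hy i) hl, by group⟩
end
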